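/- arXiv:2203.14562 — 2 statements merged into one kernel-verified Lean document; each statement's English description precedes it below -/
import Mathlib

section
/- For the 9-parameter Voigt parameterization of a fourth-order harmonic tensor H by (Λ₁,Λ₂,Λ₃,X₁,X₂,Y₁,Y₂,Z₁,Z₂), the invariant J₂ = H_{ijkl}H_{ijkl} equals 2(4Λ₁² + Λ₁Λ₂ + Λ₁Λ₃ + 4Λ₂² + Λ₂Λ₃ + 4Λ₃² + 8X₁² + 4X₁X₂ + 4X₂² + 8Y₁² + 4Y₁Y₂ + 4Y₂² + 8Z₁² + 4Z₁Z₂ + 4Z₂²). -/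
/-- Value of a component of the 9-parameter harmonic fourth-order tensor in
terms of the multiplicities of the indices `0`, `1`, `2` among `(i,j,k,l)`,
following the standard Voigt parameterization. -/
def harmonicVal (Λ₁ Λ₂ Λ₃ X₁ X₂ Y₁ Y₂ Z₁ Z₂ : ℝ) : ℕ → ℕ → ℕ → ℝ
  | 4, 0, 0 => Λ₂ + Λ₃
  | 0, 4, 0 => Λ₃ + Λ₁
  | 0, 0, 4 => Λ₁ + Λ₂
  | 2, 2, 0 => -Λ₃
  | 2, 0, 2 => -Λ₂
  | 0, 2, 2 => -Λ₁
  | 2, 1, 1 => -X₁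
  | 0, 3, 1 => -X₂
  | 0, 1, 3 => X₁ + X₂
  | 3, 0, 1 => Y₁ + Y₂
  | 1, 2, 1 => -Y₁
  | 1, 0, 3 => -Y₂
  | 3, 1, 0 => -Z₂
  | 1, 3, 0 => Z₁ + Z₂
  | 1, 1, 2 => -Z₁
  | _, _, _ => 0

/-- For the 9-parameter Voigt parameterization of a fourth-order
harmonic tensor `H` by `(Λ₁,Λ₂,Λ₃,X₁,X₂,Y₁,Y₂,Z₁,Z₂)`, the invariant
`J₂ = H_{ijkl}H_{ijkl}` equals the stated quadratic form. -/
theorem J2_of_harmonic_parameterization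
    (Λ₁ Λ₂ Λ₃ X₁ X₂ Y₁ Y₂ Z₁ Z₂ : ℝ)
    (H : Fin 3 → Fin 3 → Fin 3 → Fin 3 → ℝ)
    (hH : ∀ i j k l : Fin 3, H i j k l =
      harmonicVal Λ₁ Λ₂ Λ₃ X₁ X₂ Y₁ Y₂ Z₁ Z₂
        ([i, j, k, l].count 0) ([i, j, k, l].count 1) ([i, j, k, l].count 2)) :
    (∑ i : Fin 3, ∑ j : Fin 3, ∑ k : Fin 3, ∑ l : Fin 3,
        H i j k l * H i j k l)
      = 2 * (4 * Λ₁ ^ 2 + Λ₁ * Λ₂ + Λ₁ * Λ₃ + 4 * Λ₂ ^ 2 + Λ₂ * Λ₃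
          + 4 * Λ₃ ^ 2 + 8 * X₁ ^ 2 + 4 * X₁ * X₂ + 4 * X₂ ^ 2
          + 8 * Y₁ ^ 2 + 4 * Y₁ * Y₂ + 4 * Y₂ ^ 2
          + 8 * Z₁ ^ 2 + 4 * Z₁ * Z₂ + 4 * Z₂ ^ 2) := by
  simp only [hH, Fin.sum_univ_three]
  simp [List.count_cons, harmonicVal]
  ring
end

section
/- If a harmonic fourth-order tensor H satisfies d₂'(H) = 0 (i.e., H∴H is isotropic) and λ is a traceless symmetric 3×3 matrix, then S(λ)∴H = H∴S(λ), where (A∴B)_{ij} = A_{ipqr}B_{pqrj} and S(λ) = (H·λ)^s − (3/7) Id⊙(H:λ). -/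
/-- Fourth-order tensors on `ℝ³`. -/
abbrev T4 := Fin 3 → Fin 3 → Fin 3 → Fin 3 → ℝ

/-- Kronecker delta on `Fin 3`. -/
noncomputable def kd (i j : Fin 3) : ℝ := if i = j then 1 else 0

/-- Total symmetrization of a fourth-order tensor. -/
noncomputable def tsym (T : T4) : T4 := fun i j k l =>
  (∑ σ : Equiv.Perm (Fin 4),
    T (![i, j, k, l] (σ 0)) (![i, j, k, l] (σ 1))
      (![i, j, k, l] (σ 2)) (![i, j, k, l] (σ 3))) / 24

/-- Symmetrized tensor product `Id ⊙ a` of the identity with a symmetric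
second-order tensor `a`. -/
noncomputable def idSym (a : Fin 3 → Fin 3 → ℝ) : T4 := fun i j k l =>
  (kd i j * a k l + kd i k * a j l + kd i l * a j k
    + kd k l * a i j + kd j l * a i k + kd j k * a i l) / 6

/-- `H` is totally symmetric. -/
def TotSymm (H : T4) : Prop :=
  ∀ i j k l, H i j k l = H j i k l ∧ H i j k l = H i k j l ∧
    H i j k l = H i j l k ∧ H i j k l = H k l i j

/-- `H` is traceless. -/
def Traceless4 (H : T4) : Prop := ∀ k l, ∑ i : Fin 3, H i i k l = 0

/-- The double contraction `(H : λ)_{ij} = H_{ijkl} λ_{kl}`. -/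
def dc (H : T4) (lam : Fin 3 → Fin 3 → ℝ) : Fin 3 → Fin 3 → ℝ :=
  fun i j => ∑ k : Fin 3, ∑ l : Fin 3, H i j k l * lam k l

/-- The tensor with components `H_{ijkp} λ_{pl}`. -/
def mulR (H : T4) (lam : Fin 3 → Fin 3 → ℝ) : T4 :=
  fun i j k l => ∑ p : Fin 3, H i j k p * lam p l

/-- `S(λ) = (H·λ)^s − (3/7) Id ⊙ (H:λ)`. -/
noncomputable def Sten (H : T4) (lam : Fin 3 → Fin 3 → ℝ) : T4 := fun i j k l =>
  tsym (mulR H lam) i j k l - (3 / 7) * idSym (dc H lam) i j k l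

/-- The quadratic covariant `d₂(H)_{ij} = H_{ipqr} H_{pqrj}`. -/
def d2 (H : T4) : Fin 3 → Fin 3 → ℝ := fun i j =>
  ∑ p : Fin 3, ∑ q : Fin 3, ∑ r : Fin 3, H i p q r * H p q r j

/-- Deviatoric part of a second-order tensor. -/
noncomputable def dev (a : Fin 3 → Fin 3 → ℝ) : Fin 3 → Fin 3 → ℝ := fun i j =>
  a i j - (∑ k : Fin 3, a k k) / 3 * kd i j

/-- The symmetrization of `H·λ`, written out for totally symmetric `H`. -/
lemma tsym_mulR (H : T4) (hH : TotSymm H) (lam : Fin 3 → Fin 3 → ℝ) (i j k l : Fin 3) :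
    tsym (mulR H lam) i j k l = ((∑ s, H j k l s * lam s i) + (∑ s, H i k l s * lam s j)
      + (∑ s, H i j l s * lam s k) + (∑ s, H i j k s * lam s l)) / 4 := by
  have h12 : ∀ a b c d, mulR H lam a b c d = mulR H lam b a c d := fun a b c d => by
    simp only [mulR]
    exact Finset.sum_congr rfl fun s _ => by rw [(hH a b c s).1]
  have h23 : ∀ a b c d, mulR H lam a b c d = mulR H lam a c b d := fun a b c d => by
    simp only [mulR]
    exact Finset.sum_congr rfl fun s _ => by rw [(hH a b c s).2.1]
  change _ = (mulR H lam j k l i + mulR H lam i k l j + mulR H lam i j l k + mulR H lam i j k l) / 4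
  have key : ∀ a b c d, mulR H lam a c b d = mulR H lam a b c d ∧
      mulR H lam b a c d = mulR H lam a b c d ∧ mulR H lam b c a d = mulR H lam a b c d ∧
      mulR H lam c a b d = mulR H lam a b c d ∧ mulR H lam c b a d = mulR H lam a b c d := by
    intro a b c d
    refine ⟨h23 .., h12 .., ?_, ?_, ?_⟩
    · rw [h23, h12]
    · rw [h12, h23]
    · rw [h12, h23, h12]
  generalize mulR H lam = M at *
  obtain ⟨a1, a2, a3, a4, a5⟩ := key j k l i
  obtain ⟨b1, b2, b3, b4, b5⟩ := key i k l j
  obtain ⟨c1, c2, c3, c4, c5⟩ := key i j l k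
  obtain ⟨d1, d2, d3, d4, d5⟩ := key i j k l
  have hs : ∀ f : Equiv.Perm (Fin 4) → ℝ, ∑ σ, f σ = ∑ a : Fin 4, ∑ b : Fin 3, ∑ c : Fin 2,
      f (Equiv.Perm.decomposeFin.symm (a, Equiv.Perm.decomposeFin.symm (b,
        Equiv.Perm.decomposeFin.symm (c, 1)))) := by
    intro f
    rw [← Equiv.sum_comp Equiv.Perm.decomposeFin.symm, Fintype.sum_prod_type]
    refine Finset.sum_congr rfl fun a _ => ?_
    rw [← Equiv.sum_comp Equiv.Perm.decomposeFin.symm, Fintype.sum_prod_type]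
    refine Finset.sum_congr rfl fun b _ => ?_
    rw [← Equiv.sum_comp Equiv.Perm.decomposeFin.symm, Fintype.sum_prod_type]
    refine Finset.sum_congr rfl fun c _ => ?_
    rw [Fintype.sum_unique]
    congr 5
  have ev : tsym M i j k l = (M i j k l + M i j l k + M i k j l + M i k l j + M i l j k + M i l k j
    + M j i k l + M j i l k + M j k i l + M j k l i + M j l i k + M j l k i
    + M k i j l + M k i l j + M k j i l + M k j l i + M k l i j + M k l j i
    + M l i j k + M l i k j + M l j i k + M l j k i + M l k i j + M l k j i) / 24 := by
    unfold tsym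
    rw [hs]
    simp only [Fin.sum_univ_four, Fin.sum_univ_three, Fin.sum_univ_two]
    congr 1
    have e : ∀ (a : Fin 4) (b : Fin 3) (c : Fin 2) (x : Fin 4), ∀ y, 
      (Equiv.Perm.decomposeFin.symm (a, Equiv.Perm.decomposeFin.symm (b,
        Equiv.Perm.decomposeFin.symm (c, (1 : Equiv.Perm (Fin 1)))))) x = y →
      ![i, j, k, l] ((Equiv.Perm.decomposeFin.symm (a, Equiv.Perm.decomposeFin.symm (b,
        Equiv.Perm.decomposeFin.symm (c, (1 : Equiv.Perm (Fin 1)))))) x) = ![i,j,k,l] y := by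
      rintro a b c x y rfl; rfl
    simp only [e 0 0 0 0 0 (by decide), e 0 0 0 1 1 (by decide), e 0 0 0 2 2 (by decide), e 0 0 0 3 3 (by decide), e 0 0 1 0 0 (by decide), e 0 0 1 1 1 (by decide), e 0 0 1 2 3 (by decide), e 0 0 1 3 2 (by decide), e 0 1 0 0 0 (by decide), e 0 1 0 1 2 (by decide), e 0 1 0 2 1 (by decide), e 0 1 0 3 3 (by decide), e 0 1 1 0 0 (by decide), e 0 1 1 1 2 (by decide), e 0 1 1 2 3 (by decide), e 0 1 1 3 1 (by decide), e 0 2 0 0 0 (by decide), e 0 2 0 1 3 (by decide), e 0 2 0 2 2 (by decide), e 0 2 0 3 1 (by decide), e 0 2 1 0 0 (by decide), e 0 2 1 1 3 (by decide), e 0 2 1 2 1 (by decide), e 0 2 1 3 2 (by decide), e 1 0 0 0 1 (by decide), e 1 0 0 1 0 (by decide), e 1 0 0 2 2 (by decide), e 1 0 0 3 3 (by decide), e 1 0 1 0 1 (by decide), e 1 0 1 1 0 (by decide), e 1 0 1 2 3 (by decide), e 1 0 1 3 2 (by decide), e 1 1 0 0 1 (by decide), e 1 1 0 1 2 (by decide),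 e 1 1 0 2 0 (by decide), e 1 1 0 3 3 (by decide), e 1 1 1 0 1 (by decide), e 1 1 1 1 2 (by decide), e 1 1 1 2 3 (by decide), e 1 1 1 3 0 (by decide), e 1 2 0 0 1 (by decide), e 1 2 0 1 3 (by decide), e 1 2 0 2 2 (by decide), e 1 2 0 3 0 (by decide), e 1 2 1 0 1 (by decide), e 1 2 1 1 3 (by decide), e 1 2 1 2 0 (by decide), e 1 2 1 3 2 (by decide), e 2 0 0 0 2 (by decide), e 2 0 0 1 1 (by decide), e 2 0 0 2 0 (by decide), e 2 0 0 3 3 (by decide), e 2 0 1 0 2 (by decide), e 2 0 1 1 1 (by decide), e 2 0 1 2 3 (by decide), e 2 0 1 3 0 (by decide), e 2 1 0 0 2 (by decide), e 2 1 0 1 0 (by decide), e 2 1 0 2 1 (by decide), e 2 1 0 3 3 (by decide), e 2 1 1 0 2 (by decide), e 2 1 1 1 0 (by decide), e 2 1 1 2 3 (by decide), e 2 1 1 3 1 (by decide), e 2 2 0 0 2 (by decide), e 2 2 0 1 3 (by decide), e 2 2 0 2 0 (by decide), e 2 2 0 3 1 (by decide), e 2 2 1 0 2 (by decide), e 2 2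 1 1 3 (by decide), e 2 2 1 2 1 (by decide), e 2 2 1 3 0 (by decide), e 3 0 0 0 3 (by decide), e 3 0 0 1 1 (by decide), e 3 0 0 2 2 (by decide), e 3 0 0 3 0 (by decide), e 3 0 1 0 3 (by decide), e 3 0 1 1 1 (by decide), e 3 0 1 2 0 (by decide), e 3 0 1 3 2 (by decide), e 3 1 0 0 3 (by decide), e 3 1 0 1 2 (by decide), e 3 1 0 2 1 (by decide), e 3 1 0 3 0 (by decide), e 3 1 1 0 3 (by decide), e 3 1 1 1 2 (by decide), e 3 1 1 2 0 (by decide), e 3 1 1 3 1 (by decide), e 3 2 0 0 3 (by decide), e 3 2 0 1 0 (by decide), e 3 2 0 2 2 (by decide), e 3 2 0 3 1 (by decide), e 3 2 1 0 3 (by decide), e 3 2 1 1 0 (by decide), e 3 2 1 2 1 (by decide), e 3 2 1 3 2 (by decide)]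
    simp only [Matrix.cons_val]
    ring
  rw [ev]
  linarith

lemma sum_kd (i : Fin 3) (f : Fin 3 → ℝ) : ∑ p, kd i p * f p = f i := by
  simp [kd]

/-- If a harmonic fourth-order tensor `H` satisfies `d₂'(H) = 0`
and `λ` is traceless symmetric, then `S(λ) ∴ H = H ∴ S(λ)`. -/
theorem Sten_triple_contraction_comm
    (H : T4) (hH : TotSymm H) (hHtr : Traceless4 H)
    (lam : Fin 3 → Fin 3 → ℝ) (hls : ∀ i j, lam i j = lam j i)
    (hltr : ∑ i : Fin 3, lam i i = 0)
    (hd2 : ∀ i j, dev (d2 H) i j = 0) :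
    ∀ i j, (∑ p : Fin 3, ∑ q : Fin 3, ∑ r : Fin 3,
        Sten H lam i p q r * H p q r j)
      = ∑ p : Fin 3, ∑ q : Fin 3, ∑ r : Fin 3,
        H i p q r * Sten H lam p q r j := by
  have hSt : ∀ i p q r, Sten H lam i p q r =
      ((∑ s, H p q r s * lam s i) + (∑ s, H i q r s * lam s p)
      + (∑ s, H i p r s * lam s q) + (∑ s, H i p q s * lam s r)) / 4
      - (3 / 7) * idSym (dc H lam) i p q r := fun i p q r => by
    simp only [Sten, tsym_mulR H hH]
  have h12 : ∀ a b c d, H a b c d = H b a c d := fun a b c d => (hH a b c d).1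
  have h23 : ∀ a b c d, H a b c d = H a c b d := fun a b c d => (hH a b c d).2.1
  have h34 : ∀ a b c d, H a b c d = H a b d c := fun a b c d => (hH a b c d).2.2.1
  have ha : ∀ i j, dc H lam i j = dc H lam j i := fun i j => by
    simp only [dc, h12 i j]
  have hrot : ∀ p q r j, H p q r j = H j p q r := fun p q r j => by
    rw [h34, h23, h12]
  have hSrot : ∀ p q r j, Sten H lam p q r j = Sten H lam j p q r := fun p q r j => by
    have hk : ∀ a b, kd a b = kd b a := fun a b => by simp only [kd, eq_comm]
    have e1 : ∑ s, H q r j s * lam s p = ∑ s, H j q r s * lam s p :=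
      Finset.sum_congr rfl fun s _ => by rw [h23, h12]
    have e2 : ∑ s, H p r j s * lam s q = ∑ s, H j p r s * lam s q :=
      Finset.sum_congr rfl fun s _ => by rw [h23, h12]
    have e3 : ∑ s, H p q j s * lam s r = ∑ s, H j p q s * lam s r :=
      Finset.sum_congr rfl fun s _ => by rw [h23, h12]
    rw [hSt, hSt, e1, e2, e3]
    simp only [idSym]
    rw [hk j p, hk j q, hk j r, ha j r, ha j q, ha j p]
    ring
  have hd : ∀ i j, d2 H i j = (∑ k, d2 H k k) / 3 * kd i j := fun i j => by
    have := hd2 i j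
    simp only [dev] at this
    linarith
  have tr23 : ∀ p j, ∑ q, H p q q j = 0 := fun p j => by
    rw [← hHtr p j]
    exact Finset.sum_congr rfl fun q _ => by rw [h12, h23]
  -- the six contractions
  have P1 : ∀ i j, ∑ p, ∑ q, ∑ r, (∑ s, H p q r s * lam s i) * H p q r j
      = (∑ k, d2 H k k) / 3 * lam j i := fun i j => by
    have : ∑ s, lam s i * d2 H j s = (∑ k, d2 H k k) / 3 * lam j i := by
      simp only [fun s => hd j s]
      rw [← sum_kd j (fun s => lam s i), Finset.mul_sum]
      exact Finset.sum_congr rfl fun s _ => by ring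
    rw [← this]
    simp only [d2, ← hrot _ _ _ j, Fin.sum_univ_three]
    ring
  have P2 : ∀ i j, ∑ p, ∑ q, ∑ r, (∑ s, H i q r s * lam s p) * H p q r j
      = ∑ p, ∑ q, ∑ r, (∑ s, H j q r s * lam s p) * H p q r i := fun i j => by
    have g : ∀ p q r i, H p q r i = H i q r p := fun p q r i => by
      rw [hrot, h23, h34]
    simp only [fun p q r => g p q r i, fun p q r => g p q r j, Fin.sum_univ_three,
      hls 1 0, hls 2 0, hls 2 1]
    ring
  have P3 : ∀ i j, ∑ p, ∑ q, ∑ r, (∑ s, H i p r s * lam s q) * H p q r j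
      = ∑ p, ∑ q, ∑ r, (∑ s, H i q r s * lam s p) * H p q r j := fun i j => by
    rw [Finset.sum_comm]
    simp only [fun p q r => h12 p q r j]
  have P4 : ∀ i j, ∑ p, ∑ q, ∑ r, (∑ s, H i p q s * lam s r) * H p q r j
      = ∑ p, ∑ q, ∑ r, (∑ s, H i q r s * lam s p) * H p q r j := fun i j => by
    rw [← P3]
    refine Finset.sum_congr rfl fun p _ => ?_
    rw [Finset.sum_comm]
    simp only [fun q r => h23 p q r j]
  have Q : ∀ i j, ∑ p, ∑ q, ∑ r, idSym (dc H lam) i p q r * H p q r j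
      = (∑ q, ∑ r, dc H lam q r * H i j q r) / 2 := fun i j => by
    generalize dc H lam = a at *
    have t0 : ∀ p, H p 0 0 j + H p 1 1 j + H p 2 2 j = 0 := fun p => by
      rw [← tr23 p j, Fin.sum_univ_three]
    have q1 : ∑ p, ∑ q, ∑ r, kd i p * a q r * H p q r j = ∑ q, ∑ r, a q r * H i j q r := by
      rw [← sum_kd i (fun p => ∑ q, ∑ r, a q r * H p j q r)]
      simp only [Finset.mul_sum, mul_assoc]
      refine Finset.sum_congr rfl fun p _ => Finset.sum_congr rfl fun q _ =>
        Finset.sum_congr rfl fun r _ => ?_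
      rw [h34 p q r j, h23 p q j r]
    have q2 : ∑ p, ∑ q, ∑ r, kd i q * a p r * H p q r j = ∑ q, ∑ r, a q r * H i j q r := by
      rw [Finset.sum_comm, ← q1]
      simp only [fun p q r => h12 p q r j]
    have q3 : ∑ p, ∑ q, ∑ r, kd i r * a p q * H p q r j = ∑ q, ∑ r, a q r * H i j q r := by
      rw [← q2]
      refine Finset.sum_congr rfl fun p _ => ?_
      rw [Finset.sum_comm]
      simp only [fun q r => h23 p q r j]
    have q4 : ∑ p, ∑ q, ∑ r, kd q r * a i p * H p q r j = 0 := by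
      refine Finset.sum_eq_zero fun p _ => ?_
      have : ∀ q, ∑ r, kd q r * a i p * H p q r j = a i p * H p q q j := fun q => by
        rw [← sum_kd q (fun r => a i p * H p q r j)]
        simp only [mul_assoc]
      simp only [this]
      rw [← Finset.mul_sum, tr23, mul_zero]
    have q5 : ∑ p, ∑ q, ∑ r, kd p r * a i q * H p q r j = 0 := by
      rw [Finset.sum_comm, ← q4]
      simp only [fun p q r => h12 p q r j]
    have q6 : ∑ p, ∑ q, ∑ r, kd p q * a i r * H p q r j = 0 := by
      rw [← q5]
      refine Finset.sum_congr rfl fun p _ => ?_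
      rw [Finset.sum_comm]
      simp only [fun q r => h23 p q r j]
    simp only [idSym, div_mul_eq_mul_div, add_mul, ← Finset.sum_div, Finset.sum_add_distrib,
      q1, q2, q3, q4, q5, q6]
    ring
  have A : ∀ i j, ∑ p, ∑ q, ∑ r, Sten H lam i p q r * H p q r j
      = ((∑ k, d2 H k k) / 3 * lam j i
        + 3 * ∑ p, ∑ q, ∑ r, (∑ s, H i q r s * lam s p) * H p q r j) / 4
        - 3 / 7 * ((∑ q, ∑ r, dc H lam q r * H i j q r) / 2) := fun i j => by
    rw [← Q, ← P1]
    have p3 := P3 i j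
    have p4 := P4 i j
    simp only [hSt, sub_mul, div_mul_eq_mul_div, add_mul, ← Finset.sum_div,
      Finset.sum_add_distrib, Finset.sum_sub_distrib, p3, p4, mul_assoc, ← Finset.mul_sum]
    ring
  intro i j
  have B : ∑ p, ∑ q, ∑ r, H i p q r * Sten H lam p q r j
      = ∑ p, ∑ q, ∑ r, Sten H lam j p q r * H p q r i := by
    refine Finset.sum_congr rfl fun p _ => Finset.sum_congr rfl fun q _ =>
        Finset.sum_congr rfl fun r _ => ?_
    rw [hSrot, hrot p q r i, mul_comm]
  rw [B, A, A, P2 i j, hls j i]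
  simp only [fun q r => h12 i j q r]
end
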